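/- arXiv:2303.14362 — 6 statements merged into one kernel-verified Lean document; each statement's English description precedes it below -/
import Mathlib

section
/- Let V be a real separable Banach space which is reflexive (the canonical inclusion of V into its double dual is surjective), and let V' denote its continuous dual. Suppose T : V → V' is monotone (for all u, v in V, (T(u) - T(v))(u - v) ≥ 0), coercive (T(v)(v)/‖v‖ → ∞ as ‖v‖ → ∞), and demicontinuous (whenever a sequence v_k converges to v in the norm of V, T(v_k)(w) → T(v)(w) for every w in V). Then T is surjective: for every f in V' there exists u in V with T(u) = f. If moreover T is strictly monotone ((T(u) - T(v))(u - v) > 0 whenever u ≠ v), then T is also injective. -/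
open Filter Topology

lemma bm_finite {V : Type*} [NormedAddCommGroup V] [NormedSpace ℝ V]
    {ι : Type*} [Fintype ι] [Nonempty ι] (v : ι → V) (g : ι → (V →L[ℝ] ℝ))
    (hg : ∀ i j, 0 ≤ (g i - g j) (v i - v j)) :
    ∃ μ ∈ stdSimplex ℝ ι, ∀ i, 0 ≤ g i (v i - ∑ j, μ j • v j) := by
  classical
  let L : (ι → ℝ) →ₗ[ℝ] (ι → ℝ) :=
    { toFun := fun μ i => ∑ j, μ j * g i (v i - v j)
      map_add' := by
        intro a b; ext i; simp [add_mul, Finset.sum_add_distrib]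
      map_smul' := by
        intro a b; ext i; simp [Finset.mul_sum, mul_assoc] }
  have hLdef : ∀ μ i, L μ i = ∑ j, μ j * g i (v i - v j) := fun μ i => rfl
  have hL : ∀ μ ∈ stdSimplex ℝ ι, ∀ i, L μ i = g i (v i - ∑ j, μ j • v j) := by
    intro μ hμ i
    rw [hLdef]
    simp only [map_sub, map_sum, map_smul, smul_eq_mul, mul_sub, Finset.sum_sub_distrib]
    rw [← Finset.sum_mul, hμ.2, one_mul]
  by_contra hcon
  push Not at hcon
  have hdisj : Disjoint (L '' stdSimplex ℝ ι) (Set.Ici (0 : ι → ℝ)) := by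
    rw [Set.disjoint_left]
    rintro _ ⟨μ, hμ, rfl⟩ h0
    obtain ⟨i, hi⟩ := hcon μ hμ
    have := h0 i
    rw [hL μ hμ i] at this
    simp only [Pi.zero_apply] at this
    linarith
  obtain ⟨l, a, b, ha, hab, hb⟩ := geometric_hahn_banach_compact_closed
    ((convex_stdSimplex ℝ ι).linear_image L)
    ((isCompact_stdSimplex ℝ ι).image L.continuous_of_finiteDimensional)
    (convex_Ici (0 : ι → ℝ)) isClosed_Ici hdisj
  have hb0 : b < 0 := by simpa using hb 0 (by simp)
  let c : ι → ℝ := fun i => l (Pi.single i 1)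
  have hl : ∀ x : ι → ℝ, l x = ∑ i, x i * c i := by
    intro x
    conv_lhs => rw [pi_eq_sum_univ' x]
    simp [c, Pi.single_apply, map_sum, map_smul]
    try rfl
  have hc : ∀ i, 0 ≤ c i := by
    intro i
    by_contra hneg
    push Not at hneg
    have h1 := hb ((b / c i) • Pi.single i (1 : ℝ)) (by
      simp only [Set.mem_Ici]
      refine smul_nonneg (div_nonneg_of_nonpos hb0.le hneg.le) ?_
      simp [Pi.single_nonneg])
    rw [map_smul, smul_eq_mul] at h1
    change b < b / c i * c i at h1
    rw [div_mul_cancel₀ _ hneg.ne] at h1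
    exact lt_irrefl _ h1
  have key : 0 ≤ l (L c) := by
    rw [hl]
    simp only [hLdef, Finset.sum_mul]
    have h2 : 0 ≤ ∑ i, ∑ j, c i * c j * (g i - g j) (v i - v j) :=
      Finset.sum_nonneg fun i _ => Finset.sum_nonneg fun j _ =>
        mul_nonneg (mul_nonneg (hc i) (hc j)) (hg i j)
    have h3 : ∑ i, ∑ j, c i * c j * (g i - g j) (v i - v j)
        = ∑ i, ∑ j, c j * g i (v i - v j) * c i + ∑ i, ∑ j, c i * g j (v j - v i) * c j := by
      simp only [← Finset.sum_add_distrib]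
      refine Finset.sum_congr rfl fun i _ => Finset.sum_congr rfl fun j _ => ?_
      simp only [ContinuousLinearMap.sub_apply, map_sub]
      ring
    rw [Finset.sum_comm (f := fun i j => c i * g j (v j - v i) * c j)] at h3
    linarith
  have hS0 : 0 ≤ ∑ i, c i := Finset.sum_nonneg fun i _ => hc i
  rcases hS0.eq_or_lt with hS | hS
  · have hz : ∀ i, c i = 0 := by
      intro i
      exact (Finset.sum_eq_zero_iff_of_nonneg fun i _ => hc i).1 hS.symm i (Finset.mem_univ i)
    obtain ⟨i⟩ := ‹Nonempty ι›
    have := ha _ ⟨Pi.single i 1, single_mem_stdSimplex ℝ i, rfl⟩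
    rw [hl] at this
    simp [hz] at this
    linarith
  · have := ha _ ⟨(∑ i, c i)⁻¹ • c, ⟨fun i => by
      simpa using mul_nonneg (inv_nonneg.2 hS0) (hc i), by
      simp [← Finset.mul_sum, hS.ne']⟩, rfl⟩
    rw [map_smul, map_smul, smul_eq_mul] at this
    have h5 := mul_nonneg (inv_nonneg.2 hS0) key
    linarith

/-- Minty variational inequality on a ball. -/
lemma bm_ball {V : Type*} [NormedAddCommGroup V] [NormedSpace ℝ V]
    (hrefl : Function.Surjective (NormedSpace.inclusionInDoubleDual ℝ V))
    (T : V → (V →L[ℝ] ℝ)) (hmono : ∀ u v : V, 0 ≤ (T u - T v) (u - v))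
    (R : ℝ) (hR : 0 ≤ R) :
    ∃ u : V, ‖u‖ ≤ R ∧ ∀ v : V, ‖v‖ ≤ R → 0 ≤ T v (v - u) := by
  classical
  let K : Set (WeakDual ℝ (StrongDual ℝ V)) :=
    WeakDual.toStrongDual ⁻¹' Metric.closedBall 0 R
  have hK : IsCompact K := WeakDual.isCompact_closedBall 0 R
  let C : {v : V // ‖v‖ ≤ R} → Set (WeakDual ℝ (StrongDual ℝ V)) :=
    fun v => {x | x (T v) ≤ T v v}
  have hC : ∀ v, IsClosed (C v) := fun v =>
    isClosed_le (WeakDual.eval_continuous (T v)) continuous_const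
  have hne : (K ∩ ⋂ v, C v).Nonempty := by
    refine hK.inter_iInter_nonempty C hC fun s => ?_
    let s' : Finset {v : V // ‖v‖ ≤ R} := insert ⟨0, by simpa using hR⟩ s
    haveI : Nonempty s' := ⟨⟨_, Finset.mem_insert_self _ _⟩⟩
    obtain ⟨μ, hμ, h⟩ := bm_finite (fun i : s' => (i.1.1 : V)) (fun i => T i.1.1)
      (fun i j => hmono _ _)
    set u : V := ∑ j, μ j • ((j : {v : V // ‖v‖ ≤ R}) : V) with hu
    have huR : ‖u‖ ≤ R := by
      have : u ∈ Metric.closedBall (0 : V) R :=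
        (convex_closedBall (0 : V) R).sum_mem (fun i _ => hμ.1 i) hμ.2
          (fun i _ => by simpa using i.1.2)
      simpa using this
    refine ⟨StrongDual.toWeakDual (NormedSpace.inclusionInDoubleDual ℝ V u), ?_, ?_⟩
    · change NormedSpace.inclusionInDoubleDual ℝ V u ∈ Metric.closedBall 0 R
      refine (mem_closedBall_zero_iff (E := StrongDual ℝ (StrongDual ℝ V))).2 ?_
      exact (NormedSpace.double_dual_bound ℝ V u).trans huR
    · simp only [Set.mem_iInter]
      intro v hv
      have := h ⟨v, Finset.mem_insert_of_mem hv⟩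
      rw [map_sub] at this
      change T v u ≤ T v v
      linarith
  obtain ⟨x, hxK, hxC⟩ := hne
  obtain ⟨u, hu⟩ := hrefl (WeakDual.toStrongDual x)
  have hxu : ∀ φ : StrongDual ℝ V, x φ = φ u := by
    intro φ
    change (WeakDual.toStrongDual x) φ = φ u
    rw [← hu]; rfl
  refine ⟨u, ?_, fun v hv => ?_⟩
  · have h1 : WeakDual.toStrongDual x ∈ Metric.closedBall 0 R := hxK
    rw [← hu] at h1
    replace h1 := (mem_closedBall_zero_iff (E := StrongDual ℝ (StrongDual ℝ V))).1 h1
    have h2 := (NormedSpace.inclusionInDoubleDualLi ℝ (E := V)).norm_map u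
    exact h2.symm.le.trans h1
  · have h1 : x (T v) ≤ T v v := Set.mem_iInter.1 hxC ⟨v, hv⟩
    rw [hxu] at h1
    rw [map_sub]; linarith

/-- **Browder–Minty theorem.** Let `V` be a real separable reflexive Banach space and `V'`
its continuous dual. If `T : V → V'` is monotone, coercive and demicontinuous, then `T` is
surjective; if moreover `T` is strictly monotone, then `T` is injective. -/
theorem browder_minty_surjective_and_injective
    (V : Type*) [NormedAddCommGroup V] [NormedSpace ℝ V] [CompleteSpace V]
    [TopologicalSpace.SeparableSpace V]
    (hrefl : Function.Surjective (NormedSpace.inclusionInDoubleDual ℝ V))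
    (T : V → (V →L[ℝ] ℝ))
    (hmono : ∀ u v : V, 0 ≤ (T u - T v) (u - v))
    (hcoercive : ∀ M : ℝ, ∃ R : ℝ, ∀ v : V, R ≤ ‖v‖ → M ≤ T v v / ‖v‖)
    (hdemi : ∀ (v : ℕ → V) (v₀ : V), Tendsto v atTop (𝓝 v₀) →
      ∀ w : V, Tendsto (fun k => T (v k) w) atTop (𝓝 (T v₀ w))) :
    Function.Surjective T ∧
      ((∀ u v : V, u ≠ v → 0 < (T u - T v) (u - v)) → Function.Injective T) := by
  constructor
  · intro f
    obtain ⟨R₀, hR₀⟩ := hcoercive (‖f‖ + 1)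
    let R := max R₀ 1
    have hR1 : 1 ≤ R := le_max_right _ _
    obtain ⟨u, huR, hu⟩ := bm_ball hrefl (fun v => T v - f)
      (fun a b => by simpa using hmono a b) R (by linarith)
    -- passage to the limit along segments issuing from `u`
    have lim : ∀ w : V, 
        (∃ N : ℕ, ∀ n ≥ N, ‖u + (1 / ((n : ℝ) + 1)) • w‖ ≤ R) → 0 ≤ (T u - f) w := by
      rintro w ⟨N, hN⟩
      have ht : Tendsto (fun n : ℕ => u + (1 / ((n : ℝ) + 1)) • w) atTop (𝓝 u) := by
        have := (tendsto_one_div_add_atTop_nhds_zero_nat (𝕜 := ℝ)).smul_const w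
        simpa using this.const_add u
      have h2 := (hdemi _ _ ht w).sub_const (f w)
      refine ge_of_tendsto h2 (eventually_atTop.2 ⟨N, fun n hn => ?_⟩)
      have h3 := hu _ (hN n hn)
      rw [add_sub_cancel_left, map_smul, smul_eq_mul] at h3
      have hp : (0 : ℝ) < 1 / ((n : ℝ) + 1) := by positivity
      simpa using nonneg_of_mul_nonneg_right h3 hp
    have hlt : ‖u‖ < R := by
      by_contra hge
      have huR' : ‖u‖ = R := le_antisymm huR (not_lt.1 hge)
      have h1 : 0 ≤ (T u - f) (-u) := by
        refine lim _ ⟨0, fun n _ => ?_⟩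
        have hp : (0 : ℝ) < 1 / ((n : ℝ) + 1) := by positivity
        have hp1 : 1 / ((n : ℝ) + 1) ≤ 1 := by
          rw [div_le_one (by positivity)]
          have : (0 : ℝ) ≤ n := Nat.cast_nonneg n
          linarith
        have : u + (1 / ((n : ℝ) + 1)) • (-u) = (1 - 1 / ((n : ℝ) + 1)) • u := by
          rw [smul_neg, sub_smul, one_smul, sub_eq_add_neg]
        rw [this, norm_smul, Real.norm_of_nonneg (by linarith)]
        nlinarith [norm_nonneg u]
      have hpos : 0 < ‖u‖ := by rw [huR']; linarith
      have h2 := hR₀ u (by rw [huR']; exact le_max_left _ _)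
      rw [le_div_iff₀ hpos] at h2
      have h3 : f u ≤ ‖f‖ * ‖u‖ := (le_abs_self _).trans (f.le_opNorm u)
      simp at h1
      nlinarith
    have hall : ∀ w : V, 0 ≤ (T u - f) w := by
      intro w
      refine lim w ?_
      have ht : Tendsto (fun n : ℕ => ‖u + (1 / ((n : ℝ) + 1)) • w‖) atTop (𝓝 ‖u‖) := by
        have := (tendsto_one_div_add_atTop_nhds_zero_nat (𝕜 := ℝ)).smul_const w
        simpa using (this.const_add u).norm
      obtain ⟨N, hN⟩ := eventually_atTop.1 (ht.eventually (gt_mem_nhds hlt))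
      exact ⟨N, fun n hn => (hN n hn).le⟩
    refine ⟨u, ?_⟩
    ext w
    have h1 := hall w
    have h2 := hall (-w)
    simp at h1 h2
    linarith
  · intro hs a b hab
    by_contra hne
    have := hs a b hne
    simp [hab] at this
end

section
/- Let 1 < p < ∞ and let g : ℝ → ℝ be continuously differentiable and nondecreasing. Define G(t) = ∫₀^t g'(τ)^{1/p} dτ for t in ℝ. Then for every a, b in ℝ one has |a - b|^{p-2} (a - b) (g(a) - g(b)) ≥ |G(a) - G(b)|^p. -/
theorem pLaplace_aux (p : ℝ) (hp : 1 < p)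
    (g : ℝ → ℝ) (hg : ContDiff ℝ 1 g) (hmono : Monotone g)
    (G : ℝ → ℝ) (hG : ∀ t : ℝ, G t = ∫ τ in (0:ℝ)..t, (deriv g τ) ^ (1 / p))
    (a b : ℝ) (hab : b < a) :
    |G a - G b| ^ p ≤ (a - b) ^ (p - 2) * (a - b) * (g a - g b) := by
  have hp0 : 0 < p := by linarith
  have hd : 0 < a - b := sub_pos.2 hab
  have hg' : Continuous (deriv g) := hg.continuous_deriv le_rfl
  have hnn : ∀ x, 0 ≤ deriv g x := fun x => hmono.deriv_nonneg
  have hc : Continuous (fun x => (deriv g x) ^ (1 / p)) :=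
    hg'.rpow_const (fun x => Or.inr (by positivity))
  have hGab : G a - G b = ∫ τ in b..a, (deriv g τ) ^ (1 / p) := by
    rw [hG, hG]
    exact intervalIntegral.integral_interval_sub_left (hc.intervalIntegrable _ _)
      (hc.intervalIntegrable _ _)
  have hgab : ∫ τ in b..a, deriv g τ = g a - g b :=
    intervalIntegral.integral_deriv_eq_sub
      (fun x _ => (hg.differentiable one_ne_zero) x) (hg'.intervalIntegrable _ _)
  have hI : 0 ≤ ∫ τ in b..a, (deriv g τ) ^ (1 / p) :=
    intervalIntegral.integral_nonneg hab.le (fun x _ => Real.rpow_nonneg (hnn x) _)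
  have hpow : ∀ x, ((deriv g x) ^ (1 / p)) ^ p = deriv g x := fun x => by
    rw [← Real.rpow_mul (hnn x), one_div_mul_cancel hp0.ne', Real.rpow_one]
  have hJ := (convexOn_rpow hp.le).map_set_average_le (μ := MeasureTheory.volume)
    (t := Set.uIoc b a) (f := fun x => (deriv g x) ^ (1 / p))
    (Real.continuous_rpow_const hp0.le).continuousOn isClosed_Ici
    (by rw [Set.uIoc_of_le hab.le]; simp [hab])
    (by rw [Set.uIoc_of_le hab.le]; simp)
    (Filter.Eventually.of_forall fun x => Real.rpow_nonneg (hnn x) _)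
    (hc.intervalIntegrable b a).def'
    (by
      simp only [Function.comp_def, hpow]
      exact (hg'.intervalIntegrable b a).def')
  simp only [hpow] at hJ
  rw [interval_average_eq, interval_average_eq, hgab, ← hGab, smul_eq_mul, smul_eq_mul] at hJ
  rw [← hGab] at hI
  rw [abs_of_nonneg hI]
  rw [Real.mul_rpow (inv_nonneg.2 hd.le) hI, Real.inv_rpow hd.le] at hJ
  have hdp : 0 < (a - b) ^ p := Real.rpow_pos_of_pos hd p
  have h2 := mul_le_mul_of_nonneg_left hJ hdp.le
  rw [← mul_assoc, mul_inv_cancel₀ hdp.ne', one_mul] at h2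
  refine h2.trans (le_of_eq ?_)
  have h3 : (a - b) ^ p = (a - b) ^ (p - 2) * (a - b) * (a - b) := by
    rw [Real.rpow_sub hd, Real.rpow_two]
    field_simp
  rw [h3]
  field_simp

/-- For `1 < p < ∞` and a continuously differentiable nondecreasing `g : ℝ → ℝ`, setting
`G t = ∫₀^t g'(τ)^{1/p} dτ`, one has
`|a - b|^{p-2} (a - b) (g a - g b) ≥ |G a - G b|^p` for all real `a, b`. -/
theorem pLaplace_increasing_test_inequality (p : ℝ) (hp : 1 < p)
    (g : ℝ → ℝ) (hg : ContDiff ℝ 1 g) (hmono : Monotone g)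
    (G : ℝ → ℝ) (hG : ∀ t : ℝ, G t = ∫ τ in (0:ℝ)..t, (deriv g τ) ^ (1 / p)) :
    ∀ a b : ℝ, |G a - G b| ^ p ≤ |a - b| ^ (p - 2) * (a - b) * (g a - g b) := by
  intro a b
  rcases lt_trichotomy a b with h | h | h
  · have := pLaplace_aux p hp g hg hmono G hG b a h
    rw [abs_sub_comm (G a), abs_sub_comm a, abs_of_pos (sub_pos.2 h)]
    refine this.trans (le_of_eq ?_)
    ring
  · subst h
    simp [Real.zero_rpow (by linarith : p ≠ 0)]
  · have := pLaplace_aux p hp g hg hmono G hG a b h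
    rwa [abs_of_pos (sub_pos.2 h)]
end

section
/- Let 1 < p < ∞. For every pair of real numbers a, b, writing a_- = min{a, 0} and b_- = min{b, 0}, one has |a - b|^{p-2} (a - b) (a_- - b_-) ≥ |a_- - b_-|^p. -/
/-- For `1 < p < ∞` and all real `a, b`, with `a_- = min {a, 0}` and `b_- = min {b, 0}`,
one has `|a - b|^{p-2} (a - b) (a_- - b_-) ≥ |a_- - b_-|^p`. -/
theorem pLaplace_negative_part_inequality (p : ℝ) (hp : 1 < p) (a b : ℝ) :
    |min a 0 - min b 0| ^ p ≤ |a - b| ^ (p - 2) * (a - b) * (min a 0 - min b 0) := by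
  have hle : |min a 0 - min b 0| ≤ |a - b| := by
    grind
  have hnn : 0 ≤ (a - b) * (min a 0 - min b 0) := by
    rcases le_total a b with h | h
    · exact mul_nonneg_of_nonpos_of_nonpos (by linarith)
        (by linarith [min_le_min_right (0 : ℝ) h])
    · exact mul_nonneg (by linarith) (by linarith [min_le_min_right (0 : ℝ) h])
  have hprod : (a - b) * (min a 0 - min b 0) = |a - b| * |min a 0 - min b 0| := by
    rw [← abs_mul, abs_of_nonneg hnn]
  rw [mul_assoc, hprod]
  have hm0 : 0 ≤ |min a 0 - min b 0| := abs_nonneg _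
  generalize |min a 0 - min b 0| = m at *
  generalize hd : |a - b| = d at *
  by_cases hm : 0 < m
  · have hdpos : 0 < d := lt_of_lt_of_le hm hle
    have e1 : m ^ p = m ^ (p - 1) * m := by
      rw [← Real.rpow_add_one hm.ne']; congr 1; ring
    have e2 : d ^ (p - 2) * d = d ^ (p - 1) := by
      rw [← Real.rpow_add_one hdpos.ne']; congr 1; ring
    rw [e1, ← mul_assoc, e2]
    exact mul_le_mul_of_nonneg_right
      (Real.rpow_le_rpow hm.le hle (by linarith)) hm.le
  · have : m = 0 := le_antisymm (not_lt.mp hm) hm0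
    rw [this, Real.zero_rpow (by linarith)]; simp
end

section
/- Let 1 < p < ∞ and γ ≥ 1. Then for all real numbers a ≥ 0 and b ≥ 0, one has |a - b|^{p-2} (a - b) (a^γ - b^γ) ≥ γ (p/(γ + p - 1))^p |a^{(γ+p-1)/p} - b^{(γ+p-1)/p}|^p. -/
theorem tangent_aux (p x m : ℝ) (hp : 1 < p) (hx : 0 ≤ x) (hm : 0 < m) :
    0 ≤ x ^ p - p * m ^ (p - 1) * x + (p - 1) * m ^ p := by
  have h := one_add_mul_self_le_rpow_one_add (s := x / m - 1)
    (by have : 0 ≤ x / m := by positivity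
        linarith) hp.le
  have e : 1 + (x / m - 1) = x / m := by ring
  rw [e, Real.div_rpow hx hm.le] at h
  have hmp : 0 < m ^ p := by positivity
  rw [le_div_iff₀ hmp] at h
  have e2 : m ^ p = m ^ (p - 1) * m := by
    rw [Real.rpow_sub_one hm.ne']
    field_simp
  have e3 : (1 + p * (x / m - 1)) * m ^ p = p * m ^ (p - 1) * x - (p - 1) * m ^ p := by
    rw [e2]
    field_simp
    ring
  linarith

theorem main_aux (p γ : ℝ) (hp : 1 < p) (hγ : 1 ≤ γ)
    (a b : ℝ) (hb : 0 ≤ b) (hab : b < a) :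
    γ * (p / (γ + p - 1)) ^ p *
        (a ^ ((γ + p - 1) / p) - b ^ ((γ + p - 1) / p)) ^ p ≤
      (a - b) ^ (p - 1) * (a ^ γ - b ^ γ) := by
  obtain ⟨q, hq⟩ : ∃ q, q = (γ + p - 1) / p := ⟨_, rfl⟩
  have hp0 : 0 < p := by linarith
  have hg0 : 0 < γ := by linarith
  have hn : 0 < γ + p - 1 := by linarith
  have hq0 : 0 < q := by rw [hq]; positivity
  have hqi : p / (γ + p - 1) = q⁻¹ := by rw [hq, inv_div]
  have hqp : (q - 1) * p = γ - 1 := by rw [hq]; field_simp; ring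
  rw [← hq, hqi]
  have hA : 0 < a ^ q - b ^ q := sub_pos.2 (Real.rpow_lt_rpow hb hab hq0)
  have hd : 0 < a - b := sub_pos.2 hab
  obtain ⟨m, hm⟩ : ∃ m, m = q⁻¹ * (a ^ q - b ^ q) / (a - b) := ⟨_, rfl⟩
  have hm0 : 0 < m := by rw [hm]; positivity
  have hmd : m * (a - b) = q⁻¹ * (a ^ q - b ^ q) := by rw [hm]; field_simp
  have hmono : MonotoneOn (fun t : ℝ => γ⁻¹ * t ^ γ - p * m ^ (p - 1) * (q⁻¹ * t ^ q)
      + (p - 1) * m ^ p * t) (Set.Ici 0) := by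
    apply monotoneOn_of_hasDerivWithinAt_nonneg (f' := fun t : ℝ =>
      γ⁻¹ * (γ * t ^ (γ - 1)) - p * m ^ (p - 1) * (q⁻¹ * (q * t ^ (q - 1)))
      + (p - 1) * m ^ p * 1) (convex_Ici 0)
    · have h1 := Real.continuous_rpow_const hg0.le
      have h2 := Real.continuous_rpow_const hq0.le
      fun_prop
    · intro t ht
      rw [interior_Ici] at ht
      have ht0 : t ≠ 0 := ne_of_gt ht
      apply HasDerivAt.hasDerivWithinAt
      exact (((Real.hasDerivAt_rpow_const (Or.inl ht0)).const_mul _).sub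
        (((Real.hasDerivAt_rpow_const (Or.inl ht0)).const_mul _).const_mul _)).add
        ((hasDerivAt_id t).const_mul _)
    · intro t ht
      rw [interior_Ici] at ht
      have ht0 : 0 < t := ht
      have h := tangent_aux p (t ^ (q - 1)) m hp (by positivity) hm0
      rw [← Real.rpow_mul ht0.le, hqp] at h
      rw [inv_mul_cancel_left₀ hg0.ne', inv_mul_cancel_left₀ hq0.ne', mul_one]
      exact h
  have h := hmono (Set.mem_Ici.2 hb) (Set.mem_Ici.2 (hb.trans hab.le)) hab.le
  simp only at h
  have e2 : m ^ p = m ^ (p - 1) * m := by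
    rw [Real.rpow_sub_one hm0.ne']
    field_simp
  have e3 : (a - b) ^ p = (a - b) ^ (p - 1) * (a - b) := by
    rw [Real.rpow_sub_one hd.ne']
    field_simp
  have key : m ^ p * (a - b) ≤ γ⁻¹ * (a ^ γ - b ^ γ) := by
    have e4 : p * m ^ (p - 1) * (m * (a - b)) = p * m ^ p * (a - b) := by rw [e2]; ring
    rw [hmd] at e4
    linarith
  have key2 : γ * (m ^ p * (a - b)) ≤ a ^ γ - b ^ γ := by
    have := mul_le_mul_of_nonneg_left key hg0.le
    rwa [mul_inv_cancel_left₀ hg0.ne'] at this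
  have e5 : q⁻¹ ^ p * (a ^ q - b ^ q) ^ p = m ^ p * (a - b) ^ p := by
    rw [← Real.mul_rpow (by positivity) hA.le, ← hmd, Real.mul_rpow hm0.le hd.le]
  calc γ * q⁻¹ ^ p * (a ^ q - b ^ q) ^ p = γ * (q⁻¹ ^ p * (a ^ q - b ^ q) ^ p) := by ring
    _ = (a - b) ^ (p - 1) * (γ * (m ^ p * (a - b))) := by rw [e5, e3]; ring
    _ ≤ _ := mul_le_mul_of_nonneg_left key2 (by positivity)

theorem main_aux2 (p γ : ℝ) (hp : 1 < p) (hγ : 1 ≤ γ)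
    (a b : ℝ) (hb : 0 ≤ b) (hab : b < a) :
    γ * (p / (γ + p - 1)) ^ p *
        |a ^ ((γ + p - 1) / p) - b ^ ((γ + p - 1) / p)| ^ p ≤
      |a - b| ^ (p - 2) * (a - b) * (a ^ γ - b ^ γ) := by
  have hd : 0 < a - b := sub_pos.2 hab
  have hq0 : 0 < (γ + p - 1) / p := div_pos (by linarith) (by linarith)
  rw [abs_of_pos (sub_pos.2 (Real.rpow_lt_rpow hb hab hq0)), abs_of_pos hd]
  have e : (a - b) ^ (p - 2) * (a - b) = (a - b) ^ (p - 1) := by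
    rw [← Real.rpow_add_one hd.ne']
    congr 1
    ring
  rw [e]
  exact main_aux p γ hp hγ a b hb hab


/-- For `1 < p < ∞`, `γ ≥ 1`, and nonnegative reals `a, b`:
`|a - b|^{p-2} (a - b) (a^γ - b^γ) ≥ γ (p/(γ+p-1))^p |a^{(γ+p-1)/p} - b^{(γ+p-1)/p}|^p`. -/
theorem pLaplace_power_test_inequality (p γ : ℝ) (hp : 1 < p) (hγ : 1 ≤ γ)
    (a b : ℝ) (ha : 0 ≤ a) (hb : 0 ≤ b) :
    γ * (p / (γ + p - 1)) ^ p *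
        |a ^ ((γ + p - 1) / p) - b ^ ((γ + p - 1) / p)| ^ p ≤
      |a - b| ^ (p - 2) * (a - b) * (a ^ γ - b ^ γ) := by
  rcases lt_trichotomy b a with h | h | h
  · exact main_aux2 p γ hp hγ a b hb h
  · subst h
    simp [Real.zero_rpow (by linarith : p ≠ 0)]
  · have := main_aux2 p γ hp hγ b a ha h
    rw [abs_sub_comm (a ^ _), abs_sub_comm a b]
    linarith
end

section
/- Let 1 < p < ∞ and set J(t) = |t|^{p-2} t for t in ℝ (with J(0) = 0). Then for all real numbers a, b, c, d one has (J(a - b) - J(c - d)) · ((a - c)^+ - (b - d)^+) ≥ 0, where k^+ = max{k, 0}. -/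
lemma J_of_nonneg (p : ℝ) (hp : 1 < p) (t : ℝ) (ht : 0 ≤ t) :
    |t| ^ (p - 2) * t = t ^ (p - 1) := by
  rcases ht.eq_or_lt with h | h
  · subst h
    rw [Real.zero_rpow (by linarith : p - 1 ≠ 0), mul_zero]
  · rw [abs_of_pos h, ← Real.rpow_add_one h.ne']
    congr 1
    ring

lemma J_mono_nonneg (p : ℝ) (hp : 1 < p) (x y : ℝ) (hx : 0 ≤ x) (h : x ≤ y) :
    |x| ^ (p - 2) * x ≤ |y| ^ (p - 2) * y := by
  rw [J_of_nonneg p hp x hx, J_of_nonneg p hp y (hx.trans h)]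
  exact Real.rpow_le_rpow hx h (by linarith)

lemma J_mono (p : ℝ) (hp : 1 < p) (x y : ℝ) (h : x ≤ y) :
    |x| ^ (p - 2) * x ≤ |y| ^ (p - 2) * y := by
  rcases le_total 0 x with hx | hx
  · exact J_mono_nonneg p hp x y hx h
  · rcases le_total 0 y with hy | hy
    · exact (mul_nonpos_of_nonneg_of_nonpos (by positivity) hx).trans
        (mul_nonneg (by positivity) hy)
    · have := J_mono_nonneg p hp (-y) (-x) (by linarith) (by linarith)
      rw [abs_neg, abs_neg] at this
      linarith

/-- For `1 < p < ∞`, with `J t = |t|^{p-2} t`, for all real `a, b, c, d` one has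
`(J(a - b) - J(c - d)) ((a - c)⁺ - (b - d)⁺) ≥ 0`. -/
theorem pLaplace_positive_part_monotone (p : ℝ) (hp : 1 < p) (a b c d : ℝ) :
    0 ≤ (|a - b| ^ (p - 2) * (a - b) - |c - d| ^ (p - 2) * (c - d)) *
        (max (a - c) 0 - max (b - d) 0) := by
  rcases le_total (c - d) (a - b) with h | h
  · exact mul_nonneg (sub_nonneg.2 (J_mono p hp _ _ h))
      (sub_nonneg.2 (max_le_max_right 0 (by linarith)))
  · exact mul_nonneg_of_nonpos_of_nonpos (sub_nonpos.2 (J_mono p hp _ _ h))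
      (sub_nonpos.2 (max_le_max_right 0 (by linarith)))
end

section
/- Let 1 < p < ∞. There exist constants c = c(p) > 0 and C = C(p) > 0 such that for all real numbers a, b, k and all τ₁, τ₂ ∈ [0, 1], writing w_a = (a - k)^+ and w_b = (b - k)^+, one has |a - b|^{p-2} (a - b) (w_a τ₁^p − w_b τ₂^p) ≥ c |w_a τ₁ − w_b τ₂|^p − C (max{w_a, w_b})^p |τ₁ − τ₂|^p. -/
lemma aux_mul (p : ℝ) (hp : 1 < p) (d : ℝ) (hd : 0 ≤ d) : d ^ (p - 1) * d = d ^ p := by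
  have := Real.rpow_add_one' hd (y := p - 1) (by linarith)
  rw [← this]; congr 1; ring

lemma aux_bern (p : ℝ) (hp : 1 < p) (s t : ℝ) (hs : 0 ≤ s) (hst : s < t) :
    t ^ p - s ^ p ≤ p * t ^ (p - 1) * (t - s) := by
  have ht : 0 < t := by linarith
  have h := one_add_mul_self_le_rpow_one_add (s := (s - t) / t)
    (by rw [le_div_iff₀ ht]; linarith) hp.le
  have e1 : 1 + (s - t) / t = s / t := by field_simp; ring
  rw [e1, Real.div_rpow hs ht.le, le_div_iff₀ (by positivity)] at h
  rw [← aux_mul p hp t ht.le] at h ⊢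
  have e2 : (1 + p * ((s - t) / t)) * (t ^ (p - 1) * t)
      = t ^ (p - 1) * t + p * t ^ (p - 1) * (s - t) := by field_simp
  rw [e2] at h
  linarith

lemma aux_add (p : ℝ) (hp : 1 < p) (A E : ℝ) (hA : 0 ≤ A) (hE : 0 ≤ E) :
    (A + E) ^ p ≤ 2 ^ p * (A ^ p + E ^ p) := by
  have hA' : 0 ≤ A ^ p := by positivity
  have hE' : 0 ≤ E ^ p := by positivity
  have h2 : (0 : ℝ) ≤ 2 ^ p := by positivity
  rcases le_total A E with h | h
  · calc (A + E) ^ p ≤ (2 * E) ^ p := Real.rpow_le_rpow (by positivity) (by linarith) (by linarith)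
      _ = 2 ^ p * E ^ p := Real.mul_rpow (by norm_num) hE
      _ ≤ _ := by gcongr; linarith
  · calc (A + E) ^ p ≤ (2 * A) ^ p := Real.rpow_le_rpow (by positivity) (by linarith) (by linarith)
      _ = 2 ^ p * A ^ p := Real.mul_rpow (by norm_num) hA
      _ ≤ _ := by gcongr; linarith

lemma aux_young (p : ℝ) (hp : 1 < p) (A E : ℝ) (hA : 0 ≤ A) (hE : 0 ≤ E) :
    p * (A + E) ^ (p - 1) * E ≤
      A ^ p / 2 + p * (p * 2 ^ p + 1) ^ (p - 1) * E ^ p := by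
  have h2 : (1 : ℝ) ≤ 2 ^ p := Real.one_le_rpow (by norm_num) (by linarith)
  have hp0 : 0 < p := by linarith
  have hM : 1 ≤ p * 2 ^ p := by nlinarith
  have hA' : 0 ≤ A ^ p := by positivity
  have hE' : 0 ≤ E ^ p := by positivity
  rcases le_total A (p * 2 ^ p * E) with h | h
  · have : (A + E) ^ (p - 1) ≤ (p * 2 ^ p + 1) ^ (p - 1) * E ^ (p - 1) := by
      rw [← Real.mul_rpow (by positivity) hE]
      exact Real.rpow_le_rpow (by positivity) (by linarith) (by linarith)
    calc p * (A + E) ^ (p - 1) * E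
        ≤ p * ((p * 2 ^ p + 1) ^ (p - 1) * E ^ (p - 1)) * E := by gcongr
      _ = p * (p * 2 ^ p + 1) ^ (p - 1) * E ^ p := by rw [← aux_mul p hp E hE]; ring
      _ ≤ _ := by linarith
  · have hEA : E ≤ A := by nlinarith
    have h3 : (A + E) ^ (p - 1) ≤ 2 ^ (p - 1) * A ^ (p - 1) := by
      rw [← Real.mul_rpow (by positivity) hA]
      exact Real.rpow_le_rpow (by positivity) (by linarith) (by linarith)
    have e : (2 : ℝ) ^ p = 2 ^ (p - 1) * 2 := (aux_mul p hp 2 (by norm_num)).symm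
    have hc : 0 ≤ p * (p * 2 ^ p + 1) ^ (p - 1) * E ^ p := by positivity
    have : p * (A + E) ^ (p - 1) * E ≤ A ^ p / 2 := by
      calc p * (A + E) ^ (p - 1) * E ≤ p * (2 ^ (p - 1) * A ^ (p - 1)) * E := by gcongr
        _ = A ^ (p - 1) * (p * 2 ^ p * E) / 2 := by rw [e]; ring
        _ ≤ A ^ (p - 1) * A / 2 := by gcongr
        _ = A ^ p / 2 := by rw [aux_mul p hp A hA]
    linarith

lemma aux_core (p : ℝ) (hp : 1 < p) (x y s t : ℝ) (hy : 0 ≤ y) (hyx : y ≤ x)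
    (hs : 0 ≤ s) (ht : 0 ≤ t) :
    ((x - y) * s) ^ p / 2 - p * (p * 2 ^ p + 1) ^ (p - 1) * (x * |s - t|) ^ p ≤
      (x - y) ^ (p - 1) * (x * s ^ p - y * t ^ p) := by
  have hx : 0 ≤ x := hy.trans hyx
  have hd : 0 ≤ x - y := by linarith
  have hp0 : 0 < p := by linarith
  have e1 : (x - y) ^ (p - 1) * (x * s ^ p - y * t ^ p)
      = ((x - y) * s) ^ p - (x - y) ^ (p - 1) * (y * (t ^ p - s ^ p)) := by
    rw [Real.mul_rpow hd hs, ← aux_mul p hp (x - y) hd]; ring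
  rw [e1]
  have hA' : 0 ≤ ((x - y) * s) ^ p := by positivity
  rcases le_or_gt t s with h | h
  · have : t ^ p ≤ s ^ p := Real.rpow_le_rpow ht h hp0.le
    have h1 : 0 ≤ (x - y) ^ (p - 1) * (y * (s ^ p - t ^ p)) :=
      mul_nonneg (by positivity) (mul_nonneg hy (by linarith))
    have h2 : 0 ≤ p * (p * 2 ^ p + 1) ^ (p - 1) * (x * |s - t|) ^ p := by positivity
    linarith
  · have hab : |s - t| = t - s := by rw [abs_of_neg (by linarith)]; ring
    rw [hab]
    have hts : 0 ≤ t - s := by linarith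
    have hY := aux_young p hp ((x - y) * s) (x * (t - s)) (by positivity) (by positivity)
    have hB := aux_bern p hp s t hs h
    have h3 : ((x - y) * t) ^ (p - 1) ≤ ((x - y) * s + x * (t - s)) ^ (p - 1) :=
      Real.rpow_le_rpow (by positivity) (by nlinarith) (by linarith)
    have : (x - y) ^ (p - 1) * (y * (t ^ p - s ^ p)) ≤
        p * ((x - y) * s + x * (t - s)) ^ (p - 1) * (x * (t - s)) := by
      calc (x - y) ^ (p - 1) * (y * (t ^ p - s ^ p))
          ≤ (x - y) ^ (p - 1) * (y * (p * t ^ (p - 1) * (t - s))) := by gcongr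
        _ = p * ((x - y) * t) ^ (p - 1) * (y * (t - s)) := by
            rw [Real.mul_rpow hd ht]; ring
        _ ≤ _ := by gcongr
    linarith

lemma aux_half (p : ℝ) (hp : 1 < p) (a b k s t : ℝ) (hab : b ≤ a)
    (hs : 0 ≤ s) (ht : 0 ≤ t) :
    (2 ^ p)⁻¹ / 2 * |max (a - k) 0 * s - max (b - k) 0 * t| ^ p -
        (p * (p * 2 ^ p + 1) ^ (p - 1) + 1) *
          (max (max (a - k) 0) (max (b - k) 0)) ^ p * |s - t| ^ p ≤
      |a - b| ^ (p - 2) * (a - b) * (max (a - k) 0 * s ^ p - max (b - k) 0 * t ^ p) := by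
  have hd : 0 ≤ a - b := by linarith
  have hp0 : 0 < p := by linarith
  have e1 : |a - b| ^ (p - 2) * (a - b) = (a - b) ^ (p - 1) := by
    rw [abs_of_nonneg hd, ← Real.rpow_add_one' hd (by linarith)]; congr 1; ring
  rw [e1]
  have hxy : max (b - k) 0 ≤ max (a - k) 0 := max_le_max (by linarith) le_rfl
  rw [max_eq_left hxy]
  have hdd : max (a - k) 0 - max (b - k) 0 ≤ a - b := by
    rcases max_cases (a - k) 0 with h | h <;> rcases max_cases (b - k) 0 with h' | h' <;> linarith
  have hcase : max (b - k) 0 = 0 ∨ a - b = max (a - k) 0 - max (b - k) 0 := by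
    rcases le_total b k with h | h
    · left; exact max_eq_right (by linarith)
    · right; rw [max_eq_left (by linarith), max_eq_left (by linarith)]; ring
  have hy : 0 ≤ max (b - k) 0 := le_max_right _ _
  generalize max (a - k) 0 = x at *
  generalize max (b - k) 0 = y at *
  have hx : 0 ≤ x := hy.trans hxy
  have hC := aux_core p hp x y s t hy hxy hs ht
  have hlow : (x - y) ^ (p - 1) * (x * s ^ p - y * t ^ p) ≤
      (a - b) ^ (p - 1) * (x * s ^ p - y * t ^ p) := by
    rcases hcase with h | h
    · subst h
      have : (x - 0) ^ (p - 1) ≤ (a - b) ^ (p - 1) :=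
        Real.rpow_le_rpow (by linarith) hdd (by linarith)
      refine mul_le_mul_of_nonneg_right this ?_
      rw [zero_mul, sub_zero]; positivity
    · rw [h]
  have hxy' : 0 ≤ x - y := by linarith
  have hT : |x * s - y * t| ≤ (x - y) * s + x * |s - t| := by
    have : x * s - y * t = (x - y) * s + y * (s - t) := by ring
    rw [this]
    refine (abs_add_le _ _).trans ?_
    rw [abs_of_nonneg (by positivity : 0 ≤ (x - y) * s), abs_mul, abs_of_nonneg hy]
    gcongr
  have hT2 := (Real.rpow_le_rpow (abs_nonneg _) hT hp0.le).trans
    (aux_add p hp ((x - y) * s) (x * |s - t|) (by positivity) (by positivity))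
  have h2 : (0 : ℝ) < 2 ^ p := by positivity
  have hT3 : (2 ^ p)⁻¹ / 2 * |x * s - y * t| ^ p ≤
      (((x - y) * s) ^ p + (x * |s - t|) ^ p) / 2 := by
    have := (inv_mul_le_iff₀ h2).2 hT2
    linarith
  have hE : 0 ≤ (x * |s - t|) ^ p := by positivity
  have e2 : (p * (p * 2 ^ p + 1) ^ (p - 1) + 1) * x ^ p * |s - t| ^ p
      = p * (p * 2 ^ p + 1) ^ (p - 1) * (x * |s - t|) ^ p + (x * |s - t|) ^ p := by
    rw [Real.mul_rpow hx (abs_nonneg _)]; ring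
  rw [e2]
  linarith

/-- For `1 < p < ∞` there are constants `c = c(p) > 0` and `C = C(p) > 0` such that for
all real `a, b, k` and `τ₁, τ₂ ∈ [0, 1]`, with `w_a = (a - k)⁺` and `w_b = (b - k)⁺`,
`|a - b|^{p-2} (a - b) (w_a τ₁^p − w_b τ₂^p) ≥ c |w_a τ₁ − w_b τ₂|^p −
C (max {w_a, w_b})^p |τ₁ − τ₂|^p`. -/
theorem energy_estimate_algebraic_inequality (p : ℝ) (hp : 1 < p) :
    ∃ c C : ℝ, 0 < c ∧ 0 < C ∧ ∀ (a b k τ₁ τ₂ : ℝ),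
      τ₁ ∈ Set.Icc (0 : ℝ) 1 → τ₂ ∈ Set.Icc (0 : ℝ) 1 →
      c * |max (a - k) 0 * τ₁ - max (b - k) 0 * τ₂| ^ p -
          C * (max (max (a - k) 0) (max (b - k) 0)) ^ p * |τ₁ - τ₂| ^ p ≤
        |a - b| ^ (p - 2) * (a - b) *
          (max (a - k) 0 * τ₁ ^ p - max (b - k) 0 * τ₂ ^ p) := by

  have hp0 : 0 < p := by linarith
  refine ⟨(2 ^ p)⁻¹ / 2, p * (p * 2 ^ p + 1) ^ (p - 1) + 1, by positivity, by positivity, ?_⟩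
  intro a b k s t hs ht
  rcases le_total b a with h | h
  · exact aux_half p hp a b k s t h hs.1 ht.1
  · have := aux_half p hp b a k t s h ht.1 hs.1
    rw [abs_sub_comm a b, abs_sub_comm s t, max_comm (max (a - k) 0),
      abs_sub_comm (max (a - k) 0 * s)]
    refine this.trans (le_of_eq ?_)
    ring
end
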